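/- arXiv:2207.00910 — 6 statements merged into one kernel-verified Lean document; each statement's English description precedes it below -/
import Mathlib

section
/- Let γ > 0 and let (ζ_n)_{n≥1} be an increasing sequence of finite subsets of the interval [0,1] (ζ_n ⊆ ζ_{n+1}), each containing the endpoints 0 and 1, and for x ∈ ⋃_n ζ_n let ind(x) denote the least n with x ∈ ζ_n (the index of x). Assume: (1) for all sufficiently large n, the cardinality |ζ_n| < n^{γ+1}; (2) there exists c > 0 such that for every n the maximal gap between consecutive points of ζ_n is less than c/n. Then there exist constants P > 0 and K > 0 such that for all sufficiently large n there are two consecutive points a < b of ζ_n with b − a > P/n^{γ+1} and with ind(a) > K·n^{1/(1+γ)} and ind(b) > K·n^{1/(1+γ)}. -/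
open MeasureTheory in
/-- If finitely many intervals `[t - δ, t + δ]` (`t ∈ T`) and `[a, a + ε]` (`a ∈ S`) cover `[0, 1)`,
then their total length is at least `1`. -/
lemma one_le_total_length_of_cover (S T : Finset ℝ) {δ ε : ℝ} (hδ : 0 ≤ δ) (hε : 0 ≤ ε)
    (h : ∀ x ∈ Set.Ico (0 : ℝ) 1, (∃ t ∈ T, x ∈ Set.Icc (t - δ) (t + δ)) ∨
      ∃ a ∈ S, x ∈ Set.Icc a (a + ε)) :
    1 ≤ (T.card : ℝ) * (2 * δ) + S.card * ε := by
  have hcover : Set.Ico (0 : ℝ) 1 ⊆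
      (⋃ t ∈ T, Set.Icc (t - δ) (t + δ)) ∪ ⋃ a ∈ S, Set.Icc a (a + ε) := by
    intro x hx
    simpa only [Set.mem_union, Set.mem_iUnion, exists_prop] using h x hx
  have hvol : ENNReal.ofReal 1 ≤ ENNReal.ofReal ((T.card : ℝ) * (2 * δ) + S.card * ε) := by
    calc ENNReal.ofReal 1 = volume (Set.Ico (0 : ℝ) 1) := by simp
      _ ≤ volume (⋃ t ∈ T, Set.Icc (t - δ) (t + δ)) + volume (⋃ a ∈ S, Set.Icc a (a + ε)) :=
          (measure_mono hcover).trans (measure_union_le _ _)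
      _ ≤ ∑ t ∈ T, volume (Set.Icc (t - δ) (t + δ)) + ∑ a ∈ S, volume (Set.Icc a (a + ε)) :=
          add_le_add (measure_biUnion_finset_le _ _) (measure_biUnion_finset_le _ _)
      _ = ENNReal.ofReal ((T.card : ℝ) * (2 * δ) + S.card * ε) := by
          rw [ENNReal.ofReal_add (by positivity) (by positivity),
            ENNReal.ofReal_mul T.card.cast_nonneg, ENNReal.ofReal_mul S.card.cast_nonneg]
          simp only [Real.volume_Icc, add_sub_cancel_left, add_sub_sub_cancel, ← two_mul,
            Finset.sum_const, nsmul_eq_mul, ENNReal.ofReal_natCast]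
  exact (ENNReal.ofReal_le_ofReal_iff (by positivity)).1 hvol

/-- A point between two elements of a finite set of a linear order lies between two consecutive
elements of it. -/
lemma Finset.exists_consecutive_mem_Ico {α : Type*} [LinearOrder α] (S : Finset α) {u v x : α}
    (hu : u ∈ S) (hv : v ∈ S) (hx : x ∈ Set.Ico u v) :
    ∃ a ∈ S, ∃ b ∈ S, (∀ z ∈ S, ¬(a < z ∧ z < b)) ∧ x ∈ Set.Ico a b := by
  obtain ⟨a, ha, ha'⟩ := (S.filter (· ≤ x)).exists_maximal ⟨u, by simp [hu, hx.1]⟩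
  obtain ⟨b, hb, hb'⟩ := (S.filter (x < ·)).exists_minimal ⟨v, by simp [hv, hx.2]⟩
  simp only [Finset.mem_filter] at ha ha' hb hb'
  refine ⟨a, ha.1, b, hb.1, fun z hz ⟨haz, hzb⟩ => ?_, ha.2, hb.2⟩
  rcases le_or_gt z x with hzx | hzx
  · exact (ha' ⟨hz, hzx⟩ haz.le).not_gt haz
  · exact (hb' ⟨hz, hzx⟩ hzb.le).not_gt hzb

/-- In an increasing sequence of sets, a point which is in some set but not in the set with number
`⌊y⌋₊` has index greater than `y`. -/
lemma lt_sInf_index_of_notMem {α : Type*} {ζ : ℕ → Finset α} (hζ : Monotone ζ) {a : α} {n : ℕ}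
    {y : ℝ} (ha : a ∈ ζ n) (hay : a ∉ ζ ⌊y⌋₊) : y < (sInf {m : ℕ | a ∈ ζ m} : ℕ) := by
  have hmem : a ∈ ζ (sInf {m : ℕ | a ∈ ζ m}) := Nat.sInf_mem (s := {m : ℕ | a ∈ ζ m}) ⟨n, ha⟩
  by_contra! hle
  exact hay (hζ (Nat.le_floor hle) hmem)

/-- Lemma 3.1 (indexed interval partitions). `ζ n` is the (finite) set of cut points of the
`n`-th partition of `[0,1]`; the index of a point `x` is `sInf {m | x ∈ ζ m}`, the least `m`
with `x ∈ ζ m`.  Consecutive points of `ζ n` are `a < b` in `ζ n` with no point of `ζ n`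
strictly between them. -/
theorem stmt_0 (γ : ℝ) (hγ : 0 < γ) (ζ : ℕ → Finset ℝ)
    (hsub : ∀ n, ∀ x ∈ ζ n, x ∈ Set.Icc (0 : ℝ) 1)
    (h0 : ∀ n, (0 : ℝ) ∈ ζ n) (h1 : ∀ n, (1 : ℝ) ∈ ζ n)
    (hmono : ∀ n, ζ n ⊆ ζ (n + 1))
    (hcard : ∃ N : ℕ, ∀ n ≥ N, ((ζ n).card : ℝ) < (n : ℝ) ^ (γ + 1))
    (hgap : ∃ c > (0 : ℝ), ∀ n : ℕ, 0 < n → ∀ a ∈ ζ n, ∀ b ∈ ζ n, a < b →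
      (∀ z ∈ ζ n, ¬(a < z ∧ z < b)) → b - a < c / n) :
    ∃ P > (0 : ℝ), ∃ K > (0 : ℝ), ∃ N : ℕ, ∀ n ≥ N,
      ∃ a ∈ ζ n, ∃ b ∈ ζ n, a < b ∧ (∀ z ∈ ζ n, ¬(a < z ∧ z < b)) ∧
        b - a > P / (n : ℝ) ^ (γ + 1) ∧
        ((sInf {m : ℕ | a ∈ ζ m} : ℕ) : ℝ) > K * (n : ℝ) ^ (1 / (1 + γ)) ∧
        ((sInf {m : ℕ | b ∈ ζ m} : ℕ) : ℝ) > K * (n : ℝ) ^ (1 / (1 + γ)) := by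
  obtain ⟨N₀, hN₀⟩ := hcard
  obtain ⟨c, hc, hgap⟩ := hgap
  have hζ : Monotone ζ := monotone_nat_of_le_succ hmono
  have hγ' : γ + 1 ≠ 0 := by positivity
  set K : ℝ := (1 / (4 * c)) ^ (1 / (1 + γ)) with hK
  have hKpos : 0 < K := by positivity
  have htend : Filter.Tendsto (fun n : ℕ => K * (n : ℝ) ^ (1 / (1 + γ)))
      Filter.atTop Filter.atTop :=
    ((tendsto_rpow_atTop (by positivity)).comp tendsto_natCast_atTop_atTop).const_mul_atTop hKpos
  obtain ⟨N₁, hN₁⟩ := Filter.eventually_atTop.1 (htend.eventually_ge_atTop (N₀ : ℝ))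
  refine ⟨1 / 2, by norm_num, K, hKpos, max 1 (max N₀ N₁), fun n hn => ?_⟩
  have hn1 : 0 < n := lt_of_lt_of_le one_pos ((le_max_left _ _).trans hn)
  have hn0 : (0 : ℝ) < n := by exact_mod_cast hn1
  have hnN₀ : N₀ ≤ n := ((le_max_left _ _).trans (le_max_right _ _)).trans hn
  have hnN₁ : N₁ ≤ n := ((le_max_right _ _).trans (le_max_right _ _)).trans hn
  set y : ℝ := K * (n : ℝ) ^ (1 / (1 + γ)) with hy
  have hy0 : 0 ≤ y := by positivity
  have hS := hN₀ n hnN₀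
  have hT : ((ζ ⌊y⌋₊).card : ℝ) < n / (4 * c) := by
    calc ((ζ ⌊y⌋₊).card : ℝ) < (⌊y⌋₊ : ℝ) ^ (γ + 1) := hN₀ _ (Nat.le_floor (hN₁ n hnN₁))
      _ ≤ y ^ (γ + 1) := by
          gcongr
          exact Nat.floor_le hy0
      _ = n / (4 * c) := by
          rw [hy, hK, add_comm 1 γ, one_div (γ + 1), Real.mul_rpow (by positivity) (by positivity),
            Real.rpow_inv_rpow (by positivity) hγ', Real.rpow_inv_rpow hn0.le hγ']
          ring
  by_contra! hcon
  have hcover := one_le_total_length_of_cover (ζ n) (ζ ⌊y⌋₊) (δ := c / n)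
    (ε := 1 / 2 / (n : ℝ) ^ (γ + 1)) (by positivity) (by positivity) (fun x hx => by
      obtain ⟨a, ha, b, hb, hab, hax, hxb⟩ := (ζ n).exists_consecutive_mem_Ico (h0 n) (h1 n) hx
      have hlt : a < b := hax.trans_lt hxb
      have hg := hgap n hn1 a ha b hb hlt hab
      by_cases haT : a ∈ ζ ⌊y⌋₊
      · exact .inl ⟨a, haT, by linarith, by linarith⟩
      by_cases hbT : b ∈ ζ ⌊y⌋₊
      · exact .inl ⟨b, hbT, by linarith, by linarith⟩
      refine .inr ⟨a, ha, hax, ?_⟩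
      by_contra! hlong
      exact (lt_sInf_index_of_notMem hζ hb hbT).not_ge
        (hcon a ha b hb hlt (fun z hz haz => not_lt.1 fun hzb => hab z hz ⟨haz, hzb⟩)
          (by linarith) (lt_sInf_index_of_notMem hζ ha haT)))
  have hTlen : ((ζ ⌊y⌋₊).card : ℝ) * (2 * (c / n)) < 1 / 2 := by
    calc ((ζ ⌊y⌋₊).card : ℝ) * (2 * (c / n)) < n / (4 * c) * (2 * (c / n)) := by gcongr
      _ = 1 / 2 := by
          field_simp
          norm_num
  have hSlen : ((ζ n).card : ℝ) * (1 / 2 / (n : ℝ) ^ (γ + 1)) < 1 / 2 := by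
    calc ((ζ n).card : ℝ) * (1 / 2 / (n : ℝ) ^ (γ + 1))
        < (n : ℝ) ^ (γ + 1) * (1 / 2 / (n : ℝ) ^ (γ + 1)) := by gcongr
      _ = 1 / 2 := by field_simp
  linarith
end

section
/- Let γ > 0 and c > 0. For all sufficiently large natural numbers n (depending on c and γ) the following holds: if S is a finite subset of [0,1] containing 0 and 1 such that every closed subinterval of [0,1] of length c/n contains a point of S, and the cardinality of S is less than n^{γ+1}, then there are at least n/(6c) pairs of consecutive points a < b of S with b − a ≥ 1/(6·n^{γ+1}). -/
/-- A finite set of reals is listed by a sequence that is strictly increasing up to the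
cardinality of the set. -/
theorem Finset.exists_strictMono_enum (S : Finset ℝ) :
    ∃ f : ℕ → ℝ, (∀ i < S.card, f i ∈ S) ∧ (∀ x ∈ S, ∃ i < S.card, f i = x) ∧
      ∀ i < S.card, ∀ j < S.card, (f i < f j ↔ i < j) := by
  let e := S.orderEmbOfFin rfl
  have he : ∀ i (h : i < S.card), (if h : i < S.card then e ⟨i, h⟩ else 0) = e ⟨i, h⟩ :=
    fun i h => dif_pos h
  refine ⟨fun i => if h : i < S.card then e ⟨i, h⟩ else 0, ?_, ?_, ?_⟩
  · intro i hi
    simp only [he i hi]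
    exact S.orderEmbOfFin_mem rfl _
  · intro x hx
    have hx' : x ∈ Set.range e := by
      simpa [e, Finset.range_orderEmbOfFin] using hx
    obtain ⟨i, rfl⟩ := hx'
    exact ⟨i, i.2, he i i.2⟩
  · intro i hi j hj
    simp only [he i hi, he j hj, OrderEmbedding.lt_iff_lt, Fin.mk_lt_mk]

/-- If a finite set in `[0,1]` meets every closed subinterval of length `d`, its gaps have length
at most `d`. -/
theorem gap_le_of_meets_intervals {S : Finset ℝ} {d a b : ℝ} (ha : 0 ≤ a) (hb : b ≤ 1)
    (hS : ∀ t : ℝ, 0 ≤ t → t + d ≤ 1 → ∃ x ∈ S, x ∈ Set.Icc t (t + d))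
    (hab : ∀ z ∈ S, ¬(a < z ∧ z < b)) : b - a ≤ d := by
  by_contra! h
  obtain ⟨x, hx, hx1, hx2⟩ := hS ((a + b) / 2 - d / 2) (by linarith) (by linarith)
  exact hab x hx ⟨by linarith, by linarith⟩

/-- If finitely many reals, each at most `d`, sum to `1`, and there are at most `M` of them, then
at least `1 / (6 * d)` of them are at least `1 / (6 * M)`. -/
theorem one_div_le_card_filter_of_sum_eq_one {ι : Type*} (s : Finset ι) (g : ι → ℝ) {d M : ℝ}
    (hd : 0 < d) (hM : 0 < M) (hg : ∀ i ∈ s, g i ≤ d) (hsum : ∑ i ∈ s, g i = 1)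
    (hcard : (s.card : ℝ) ≤ M) :
    1 / (6 * d) ≤ ((s.filter fun i => 1 / (6 * M) ≤ g i).card : ℝ) := by
  rw [← Finset.sum_filter_add_sum_filter_not s (fun i => 1 / (6 * M) ≤ g i)] at hsum
  have hlarge := Finset.sum_le_card_nsmul (s.filter fun i => 1 / (6 * M) ≤ g i) g d
    fun i hi => hg i (Finset.mem_of_mem_filter i hi)
  have hsmall := Finset.sum_le_card_nsmul (s.filter fun i => ¬1 / (6 * M) ≤ g i) g (1 / (6 * M))
    fun i hi => (not_le.mp (Finset.mem_filter.mp hi).2).le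
  have hle : ((s.filter fun i => ¬1 / (6 * M) ≤ g i).card : ℝ) ≤ M :=
    le_trans (by exact_mod_cast Finset.card_filter_le _ _) hcard
  rw [nsmul_eq_mul] at hlarge hsmall
  have hsixth : M * (1 / (6 * M)) = 1 / 6 := by field_simp
  have hmul := mul_le_mul_of_nonneg_right hle (show 0 ≤ 1 / (6 * M) by positivity)
  rw [div_le_iff₀ (by positivity)]
  linarith

/-- For all sufficiently large `n`: any finite `S ⊆ [0,1]` containing `0` and `1`, meeting every
closed subinterval of length `c/n`, and of cardinality `< n^(γ+1)`, has at least `n/(6c)` pairs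
of consecutive points at distance `≥ 1/(6 n^(γ+1))`. -/
theorem stmt_1 (γ : ℝ) (hγ : 0 < γ) (c : ℝ) (hc : 0 < c) :
    ∃ N : ℕ, ∀ n ≥ N, ∀ S : Finset ℝ,
      (∀ x ∈ S, x ∈ Set.Icc (0 : ℝ) 1) → (0 : ℝ) ∈ S → (1 : ℝ) ∈ S →
      (∀ t : ℝ, 0 ≤ t → t + c / n ≤ 1 → ∃ x ∈ S, x ∈ Set.Icc t (t + c / n)) →
      ((S.card : ℝ) < (n : ℝ) ^ (γ + 1)) →
      ∃ T : Finset (ℝ × ℝ), (n : ℝ) / (6 * c) ≤ (T.card : ℝ) ∧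
        ∀ p ∈ T, p.1 ∈ S ∧ p.2 ∈ S ∧ p.1 < p.2 ∧
          (∀ z ∈ S, ¬(p.1 < z ∧ z < p.2)) ∧
          1 / (6 * (n : ℝ) ^ (γ + 1)) ≤ p.2 - p.1 := by
  refine ⟨1, fun n hn S hS h0 h1 hmeet hcard => ?_⟩
  have hn' : (0 : ℝ) < n := by exact_mod_cast hn
  obtain ⟨f, hfS, hfsurj, hflt⟩ := S.exists_strictMono_enum
  have hpos : 0 < S.card := Finset.card_pos.mpr ⟨0, h0⟩
  have hcons : ∀ i < S.card - 1, ∀ z ∈ S, ¬(f i < z ∧ z < f (i + 1)) := by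
    rintro i hi z hz ⟨hz1, hz2⟩
    obtain ⟨j, hj, rfl⟩ := hfsurj z hz
    have := (hflt i (by omega) j hj).mp hz1
    have := (hflt j hj (i + 1) (by omega)).mp hz2
    omega
  have hfirst : f 0 = 0 := by
    obtain ⟨j, hj, hj0⟩ := hfsurj 0 h0
    refine le_antisymm (not_lt.mp fun h => ?_) (hS _ (hfS 0 hpos)).1
    have := (hflt j hj 0 hpos).mp (hj0.trans_lt h)
    omega
  have hlast : f (S.card - 1) = 1 := by
    obtain ⟨j, hj, hj1⟩ := hfsurj 1 h1
    refine le_antisymm (hS _ (hfS _ (by omega))).2 (not_lt.mp fun h => ?_)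
    rw [← hj1, hflt _ (by omega) j hj] at h
    omega
  have hcount := one_div_le_card_filter_of_sum_eq_one (Finset.range (S.card - 1))
    (fun i => f (i + 1) - f i) (d := c / n) (M := (n : ℝ) ^ (γ + 1)) (by positivity)
    (by positivity)
    (fun i hi => by
      rw [Finset.mem_range] at hi
      exact gap_le_of_meets_intervals (hS _ (hfS i (by omega))).1
        (hS _ (hfS (i + 1) (by omega))).2 hmeet (hcons i hi))
    (by rw [Finset.sum_range_sub, hfirst, hlast, sub_zero])
    (by
      rw [Finset.card_range]
      exact le_trans (by exact_mod_cast Nat.sub_le _ _) hcard.le)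
  refine ⟨((Finset.range (S.card - 1)).filter
    fun i => 1 / (6 * (n : ℝ) ^ (γ + 1)) ≤ f (i + 1) - f i).image fun i => (f i, f (i + 1)), ?_, ?_⟩
  · rw [Finset.card_image_of_injOn]
    · convert hcount using 1
      field_simp
    · intro i hi j hj hij
      simp only [Finset.coe_filter, Finset.mem_range, Set.mem_ofPred_eq] at hi hj
      have heq : f i = f j := congrArg Prod.fst hij
      have := (hflt i (by omega) j (by omega)).not.mp heq.not_lt
      have := (hflt j (by omega) i (by omega)).not.mp heq.symm.not_lt
      omega
  · intro p hp
    obtain ⟨i, hi, rfl⟩ := Finset.mem_image.mp hp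
    obtain ⟨hi, hgap⟩ := Finset.mem_filter.mp hi
    rw [Finset.mem_range] at hi
    exact ⟨hfS i (by omega), hfS (i + 1) (by omega),
      (hflt i (by omega) (i + 1) (by omega)).mpr (Nat.lt_succ_self i), hcons i hi, hgap⟩
end

section
/- For Lebesgue-almost every α ∈ (0,1) and for every ε > 0 there exists a constant C = C(α, ε) > 0 such that for every μ ∈ (0, 1/2) and every x in the circle ℝ/ℤ, the finite orbit {x, x + α, x + 2α, …, x + Nα} (taken modulo 1) with N = ⌈C/μ^{2+ε}⌉ is μ-dense in ℝ/ℤ, i.e., for every y ∈ ℝ/ℤ there exists 0 ≤ k ≤ N with dist(y, x + kα) ≤ μ/2. -/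
open MeasureTheory

/-- A sequence that is positive at positive indices and eventually at least one is bounded below
by a positive constant at positive indices. -/
lemma exists_pos_le_of_eventually_one_le {f : ℕ → ℝ} (hpos : ∀ n, 0 < n → 0 < f n)
    (hf : ∀ᶠ n in Filter.atTop, 1 ≤ f n) : ∃ c > 0, ∀ n, 0 < n → c ≤ f n := by
  have hfin : ∀ N : ℕ, ∃ c > 0, ∀ n, 0 < n → n < N → c ≤ f n := by
    intro N
    induction N with
    | zero => exact ⟨1, one_pos, fun n _ h => absurd h (Nat.not_lt_zero n)⟩
    | succ N ih =>
      obtain ⟨c, hc, h⟩ := ih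
      rcases Nat.eq_zero_or_pos N with rfl | hN
      · exact ⟨1, one_pos, fun n hn h => by omega⟩
      · refine ⟨min c (f N), lt_min hc (hpos N hN), fun n hn hnN => ?_⟩
        rcases Nat.lt_succ_iff_lt_or_eq.1 hnN with hlt | rfl
        · exact (min_le_left _ _).trans (h n hn hlt)
        · exact min_le_right _ _
  obtain ⟨N, hN⟩ := Filter.eventually_atTop.1 hf
  obtain ⟨c, hc, h⟩ := hfin N
  refine ⟨min c 1, lt_min hc one_pos, fun n hn => ?_⟩
  rcases lt_or_ge n N with hlt | hge
  · exact (min_le_left _ _).trans (h n hn hlt)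
  · exact (min_le_right _ _).trans (hN n hge)

/-- An irrational number that is not Liouville with exponent `p + 1` satisfies a Diophantine
condition with exponent `p`. -/
lemma exists_pos_le_abs_mul_sub_round_mul_rpow {α p : ℝ} (hα : Irrational α)
    (hp : ¬ LiouvilleWith (p + 1) α) :
    ∃ c > 0, ∀ n : ℕ, 0 < n → c ≤ |n * α - round (n * α)| * (n : ℝ) ^ p := by
  have hne : ∀ n : ℕ, 0 < n → ∀ m : ℤ, (n : ℝ) * α ≠ m := fun n hn m =>
    (hα.natCast_mul hn.ne').ne_int m
  apply exists_pos_le_of_eventually_one_le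
  · intro n hn
    have h0 : (0 : ℝ) < n := Nat.cast_pos.2 hn
    exact mul_pos (abs_pos.2 (sub_ne_zero.2 (hne n hn _))) (Real.rpow_pos_of_pos h0 p)
  · simp only [LiouvilleWith, not_exists] at hp
    filter_upwards [Filter.not_frequently.1 (hp 1), Filter.eventually_gt_atTop 0] with n h hn
    have h0 : (0 : ℝ) < n := Nat.cast_pos.2 hn
    have key : 1 / (n : ℝ) ^ (p + 1) ≤ |α - round (n * α) / n| := by
      by_contra! hlt
      refine h ⟨round (n * α), fun heq => hne n hn (round (n * α)) ?_, hlt⟩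
      rw [eq_div_iff h0.ne'] at heq
      exact (mul_comm _ _).trans heq
    have hsub : α - round (n * α) / n = (n * α - round (n * α)) / n := by field_simp
    rw [hsub, abs_div, abs_of_pos h0, Real.rpow_add_one h0.ne',
      div_le_div_iff₀ (by positivity) h0] at key
    nlinarith

lemma AddCircle.coe_sub_intCast (t : ℝ) (m : ℤ) :
    ((t - m : ℝ) : AddCircle (1 : ℝ)) = t := by
  rw [AddCircle.coe_sub, sub_eq_self]
  exact (AddCircle.coe_eq_zero_iff 1).2 ⟨m, by simp⟩

/-- The multiples of `β` up to `1 / |β|` are `|β|`-close to every point of the circle. -/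
lemma AddCircle.exists_nat_norm_sub_nsmul_le {β : ℝ} (hβ : β ≠ 0) (u : AddCircle (1 : ℝ)) :
    ∃ j : ℕ, (j : ℝ) ≤ 1 / |β| ∧ ‖u - j • (β : AddCircle (1 : ℝ))‖ ≤ |β| := by
  obtain ⟨s, hs, hs1, rfl⟩ : ∃ s : ℝ, 0 ≤ s / β ∧ |s| ≤ 1 ∧ (s : AddCircle (1 : ℝ)) = u := by
    obtain ⟨t, rfl⟩ := QuotientAddGroup.mk_surjective u
    have h0 := Int.fract_nonneg t
    have h1 := (Int.fract_lt_one t).le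
    rcases lt_or_gt_of_ne hβ with hneg | hpos
    · refine ⟨Int.fract t - 1, div_nonneg_of_nonpos (by linarith) hneg.le,
        abs_le.2 ⟨by linarith, by linarith⟩, ?_⟩
      rw [AddCircle.coe_sub, AddCircle.coe_period, sub_zero, AddCircle.coe_fract]
    · exact ⟨Int.fract t, div_nonneg h0 hpos.le, abs_le.2 ⟨by linarith, h1⟩, AddCircle.coe_fract t⟩
  have hβ0 : 0 < |β| := abs_pos.2 hβ
  refine ⟨⌊s / β⌋₊, (Nat.floor_le hs).trans ?_, ?_⟩
  · rw [← abs_of_nonneg hs, abs_div]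
    gcongr
  · rw [← AddCircle.coe_nsmul, ← AddCircle.coe_sub, nsmul_eq_mul]
    refine (QuotientAddGroup.norm_mk_le_norm).trans ?_
    have h1 := Nat.floor_le hs
    have h2 := (Nat.lt_floor_add_one (s / β)).le
    have : s - ⌊s / β⌋₊ * β = (s / β - ⌊s / β⌋₊) * β := by field_simp
    rw [this, norm_mul, Real.norm_eq_abs, Real.norm_eq_abs]
    exact mul_le_of_le_one_left hβ0.le (abs_le.2 ⟨by linarith, by linarith⟩)

/-- An irrational number satisfying a Diophantine condition with exponent `p` has orbits of length
of order `μ ^ (-(p + 1))` that are `μ`-dense in the circle. -/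
lemma exists_nat_le_dist_add_nsmul_le {α p c μ : ℝ} (hp : 0 ≤ p) (hc : 0 < c)
    (h : ∀ n : ℕ, 0 < n → c ≤ |n * α - round (n * α)| * (n : ℝ) ^ p)
    (hμ : 0 < μ) (hμ1 : μ ≤ 1) (x y : AddCircle (1 : ℝ)) :
    ∃ k : ℕ, (k : ℝ) ≤ 3 ^ (p + 1) / c / μ ^ (p + 1) ∧
      dist y (x + k • (α : AddCircle (1 : ℝ))) ≤ μ / 2 := by
  have hQ : 0 < ⌈2 / μ⌉₊ := Nat.ceil_pos.2 (by positivity)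
  obtain ⟨q, hq, hqQ, hle⟩ := Real.exists_nat_abs_mul_sub_round_le α hQ
  set β := (q : ℝ) * α - round (q * α) with hβ
  have hq0 : (0 : ℝ) < q := Nat.cast_pos.2 hq
  have hcβ : c ≤ |β| * (q : ℝ) ^ p := h q hq
  have hβne : β ≠ 0 := by
    intro h0
    simp only [h0, abs_zero, zero_mul] at hcβ
    linarith
  have hβ0 : 0 < |β| := abs_pos.2 hβne
  have hβμ : |β| ≤ μ / 2 := by
    refine hle.trans ?_
    rw [← one_div_div 2 μ]
    exact one_div_le_one_div_of_le (by positivity) ((Nat.le_ceil _).trans (by linarith))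
  have hq3 : (q : ℝ) ≤ 3 / μ := by
    have h1 : (q : ℝ) ≤ ⌈2 / μ⌉₊ := Nat.cast_le.2 hqQ
    have h2 := (Nat.ceil_lt_add_one (a := 2 / μ) (by positivity)).le
    have h3 : 1 ≤ 1 / μ := (one_le_div hμ).2 hμ1
    have h4 : 3 / μ = 2 / μ + 1 / μ := by ring
    linarith
  obtain ⟨j, hj, hd⟩ := AddCircle.exists_nat_norm_sub_nsmul_le hβne (y - x)
  have hcoe : (β : AddCircle (1 : ℝ)) = q • (α : AddCircle (1 : ℝ)) := by
    rw [hβ, AddCircle.coe_sub_intCast, ← nsmul_eq_mul, AddCircle.coe_nsmul]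
  refine ⟨j * q, ?_, ?_⟩
  · have hβq : 1 / |β| ≤ (q : ℝ) ^ p / c := by
      rw [div_le_div_iff₀ hβ0 hc]
      linarith
    calc ((j * q : ℕ) : ℝ) = j * q := by push_cast; rfl
      _ ≤ (q : ℝ) ^ p / c * q := by gcongr; exact hj.trans hβq
      _ = (q : ℝ) ^ (p + 1) / c := by rw [Real.rpow_add_one hq0.ne']; ring
      _ ≤ (3 / μ) ^ (p + 1) / c := by gcongr
      _ = 3 ^ (p + 1) / c / μ ^ (p + 1) := by
        rw [Real.div_rpow (by norm_num) hμ.le, div_right_comm]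
  · rw [dist_eq_norm, mul_nsmul', ← sub_sub, ← hcoe]
    exact hd.trans hβμ

/-- Lemma 4.1: for Lebesgue-a.e. `α ∈ (0,1)` and every `ε > 0` there is `C > 0` such that for
every `μ ∈ (0, 1/2)` and every `x` in the circle `ℝ/ℤ`, the orbit
`{x, x+α, …, x+Nα}` with `N = ⌈C/μ^(2+ε)⌉` is `μ`-dense: every point of `ℝ/ℤ` is within
distance `μ/2` of the orbit. -/
theorem stmt_2 :
    ∀ᵐ (α : ℝ) ∂(volume.restrict (Set.Ioo (0 : ℝ) 1)),
      ∀ ε > (0 : ℝ), ∃ C > (0 : ℝ), ∀ μ : ℝ, 0 < μ → μ < 1 / 2 →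
        ∀ x y : AddCircle (1 : ℝ), ∃ k : ℕ, k ≤ ⌈C / μ ^ (2 + ε)⌉₊ ∧
          dist y (x + k • ((α : AddCircle (1 : ℝ)))) ≤ μ / 2 := by
  have hirr : ∀ᵐ α : ℝ, Irrational α := (Set.countable_range ((↑) : ℚ → ℝ)).ae_notMem volume
  refine ae_restrict_of_ae ?_
  filter_upwards [ae_not_liouvilleWith, hirr] with α hL hα ε hε
  obtain ⟨c, hc, h⟩ := exists_pos_le_abs_mul_sub_round_mul_rpow (p := 1 + ε) hα
    (hL _ (by linarith))
  refine ⟨3 ^ (2 + ε) / c, by positivity, fun μ hμ hμ2 x y => ?_⟩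
  obtain ⟨k, hk, hd⟩ :=
    exists_nat_le_dist_add_nsmul_le (by linarith) hc h hμ (by linarith) x y
  rw [show 1 + ε + 1 = 2 + ε by ring] at hk
  exact ⟨k, Nat.cast_le.1 (hk.trans (Nat.le_ceil _)), hd⟩
end

section
/- Let α ∈ (0,1) be irrational with continued fraction (convergent) denominators q_1 < q_2 < q_3 < …, and suppose there is β > 0 with lim_{n→∞} (ln q_n)/n = β. Then for every ε > 0 there exists a constant C > 0 such that for every μ ∈ (0, 1/2) and every x in the circle ℝ/ℤ, the set {x + kα (mod 1) : 0 ≤ k ≤ ⌈C/μ^{2+ε}⌉} is μ-dense in ℝ/ℤ, i.e., for every y ∈ ℝ/ℤ there exists such k with dist(y, x + kα) ≤ μ/2. -/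
namespace GenContFract

theorem not_terminatedAt_of_irrational {α : ℝ} (hα : Irrational α) (n : ℕ) :
    ¬ (GenContFract.of α).TerminatedAt n := fun h => by
  obtain ⟨r, hr⟩ := (terminates_iff_rat α).mp ⟨n, h⟩
  exact hα ⟨r, hr.symm⟩

theorem exists_int_eq_nums {α : ℝ} (hα : Irrational α) (n : ℕ) :
    ∃ p : ℤ, (GenContFract.of α).nums n = p := by
  have coeffs (m : ℕ) : ∃ (gp : Pair ℝ) (z : ℤ),
      (GenContFract.of α).s.get? m = some gp ∧ gp.a = 1 ∧ gp.b = z := by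
    obtain ⟨gp, hgp⟩ := Option.ne_none_iff_exists'.1 (not_terminatedAt_of_irrational hα m)
    obtain ⟨ha, z, hz⟩ := of_partNum_eq_one_and_exists_int_partDen_eq hgp
    exact ⟨gp, z, hgp, ha, hz⟩
  induction n using Nat.twoStepInduction with
  | zero => exact ⟨⌊α⌋, by simp⟩
  | one =>
    obtain ⟨gp, z, hgp, ha, hz⟩ := coeffs 0
    exact ⟨z * ⌊α⌋ + 1, by rw [first_num_eq hgp, ha, hz]; simp⟩
  | more n ih₀ ih₁ =>
    obtain ⟨p₀, hp₀⟩ := ih₀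
    obtain ⟨p₁, hp₁⟩ := ih₁
    obtain ⟨gp, z, hgp, ha, hz⟩ := coeffs (n + 1)
    exact ⟨z * p₁ + p₀, by rw [nums_recurrence hgp hp₀ hp₁, ha, hz]; push_cast; ring⟩

theorem exists_isCoprime_abs_sub_div_le {α : ℝ} (hα : Irrational α) {q : ℕ → ℕ}
    (hq : ∀ n, (q n : ℝ) = (GenContFract.of α).dens n) {n : ℕ} (hn : 0 < q n) :
    ∃ p : ℤ, IsCoprime p (q n : ℤ) ∧ |α - p / q n| ≤ 1 / (q n : ℝ) ^ 2 := by
  obtain ⟨p, hp⟩ := exists_int_eq_nums hα n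
  obtain ⟨p', hp'⟩ := exists_int_eq_nums hα (n + 1)
  refine ⟨p, ?_, ?_⟩
  · have hdet : (p : ℝ) * q (n + 1) - q n * p' = (-1) ^ (n + 1) := by
      rw [← hp, ← hp', hq, hq]
      exact (SimpContFract.of α).determinant (not_terminatedAt_of_irrational hα n)
    have hdet' : p * q (n + 1) - q n * p' = (-1) ^ (n + 1) := by exact_mod_cast hdet
    refine ⟨(-1) ^ (n + 1) * q (n + 1), -(-1) ^ (n + 1) * p', ?_⟩
    have hsq : ((-1 : ℤ) ^ (n + 1)) * (-1) ^ (n + 1) = 1 := by rw [← mul_pow]; simp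
    linear_combination (-1 : ℤ) ^ (n + 1) * hdet' + hsq
  · have hle := abs_sub_convs_le (not_terminatedAt_of_irrational hα n)
    have hmono : (GenContFract.of α).dens n ≤ (GenContFract.of α).dens (n + 1) := of_den_mono
    rw [conv_eq_num_div_den, hp, ← hq, ← hq] at hle
    rw [← hq, ← hq] at hmono
    have hn' : (0 : ℝ) < q n := by exact_mod_cast hn
    refine hle.trans (one_div_le_one_div_of_le (by positivity) ?_)
    rw [sq]
    gcongr

end GenContFract

theorem exists_nat_lt_abs_sub_mul_sub_le {α : ℝ} {p : ℤ} {q : ℕ} (hq : 0 < q)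
    (hpq : IsCoprime p (q : ℤ)) (h : |α - p / q| ≤ 1 / (q : ℝ) ^ 2) (z : ℝ) :
    ∃ k < q, ∃ m : ℤ, |z - k * α - m| ≤ 3 / (2 * q) := by
  obtain ⟨u, v, huv⟩ := hpq
  set t : ℤ := round (q * z)
  have hqz : (0 : ℤ) < q := by exact_mod_cast hq
  have hqr : (0 : ℝ) < q := by exact_mod_cast hq
  obtain ⟨k, hk⟩ := Int.eq_ofNat_of_zero_le (Int.emod_nonneg (t * u) hqz.ne')
  have hkq : k < q := by
    have := Int.emod_lt_of_pos (t * u) hqz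
    omega
  have hdiv := Int.emod_add_mul_ediv (t * u) q
  rw [hk] at hdiv
  set d := t * u / (q : ℤ)
  have ht : t = k * p + (d * p + t * v) * q := by
    linear_combination -t * huv - p * hdiv
  have htr : (t : ℝ) = k * p + ((d * p + t * v : ℤ) : ℝ) * q := by exact_mod_cast ht
  refine ⟨k, hkq, d * p + t * v, ?_⟩
  have hround : |z - t / q| ≤ 1 / (2 * q) := by
    have := abs_sub_round (q * z)
    have heq : z - t / q = (q * z - t) / q := by field_simp
    rw [heq, abs_div, abs_of_pos hqr, div_le_iff₀ hqr]
    refine this.trans (le_of_eq ?_)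
    field_simp
  have hdrift : |(k : ℝ) * (α - p / q)| ≤ 1 / q := by
    rw [abs_mul, Nat.abs_cast]
    calc (k : ℝ) * |α - p / q| ≤ q * (1 / (q : ℝ) ^ 2) := by gcongr
      _ = 1 / q := by field_simp
  have hsplit : z - k * α - ((d * p + t * v : ℤ) : ℝ) = (z - t / q) - k * (α - p / q) := by
    have : ((d * p + t * v : ℤ) : ℝ) = t / q - k * (p / q) := by
      field_simp
      linarith
    rw [this]
    ring
  rw [hsplit]
  calc _ ≤ |z - t / q| + |(k : ℝ) * (α - p / q)| := abs_sub _ _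
    _ ≤ 1 / (2 * q) + 1 / q := add_le_add hround hdrift
    _ = 3 / (2 * q) := by field_simp; norm_num

theorem AddCircle.exists_dist_add_nsmul_le {α δ : ℝ} {q : ℕ}
    (h : ∀ z : ℝ, ∃ k < q, ∃ m : ℤ, |z - k * α - m| ≤ δ) (x y : AddCircle (1 : ℝ)) :
    ∃ k < q, dist y (x + k • (α : AddCircle (1 : ℝ))) ≤ δ := by
  induction x using QuotientAddGroup.induction_on with | H a => ?_
  induction y using QuotientAddGroup.induction_on with | H b => ?_
  obtain ⟨k, hk, m, hm⟩ := h (b - a)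
  refine ⟨k, hk, ?_⟩
  have heq : (b : AddCircle (1 : ℝ)) - (a + k • (α : AddCircle (1 : ℝ)))
      = ((b - a - k * α : ℝ) : AddCircle (1 : ℝ)) := by
    rw [← AddCircle.coe_nsmul, ← AddCircle.coe_add, ← AddCircle.coe_sub, nsmul_eq_mul]
    congr 1
    ring
  change dist (b : AddCircle (1 : ℝ)) (a + k • (α : AddCircle (1 : ℝ))) ≤ δ
  rw [dist_eq_norm, heq]
  exact (UnitAddCircle.norm_eq ▸ round_le _ m).trans hm

open Filter in
theorem tendsto_natCast_atTop_of_log_div_tendsto {q : ℕ → ℕ} {β : ℝ} (hβ : 0 < β)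
    (hlim : Tendsto (fun n : ℕ => Real.log (q n) / n) atTop (nhds β)) :
    Tendsto (fun n => (q n : ℝ)) atTop atTop := by
  refine tendsto_atTop_mono' atTop (f₁ := fun n => Real.log (q n)) ?_ ?_
  · exact Eventually.of_forall fun n => Real.log_le_self (Nat.cast_nonneg _)
  · refine (hlim.pos_mul_atTop hβ tendsto_natCast_atTop_atTop).congr' ?_
    filter_upwards [eventually_gt_atTop 0] with n hn
    exact div_mul_cancel₀ _ (by exact_mod_cast hn.ne')

open Filter in
theorem eventually_succ_le_sq_of_log_div_tendsto {q : ℕ → ℕ} {β : ℝ} (hβ : 0 < β)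
    (hlim : Tendsto (fun n : ℕ => Real.log (q n) / n) atTop (nhds β)) :
    ∀ᶠ n in atTop, 0 < q n ∧ q (n + 1) ≤ q n ^ 2 := by
  have hpos := (tendsto_natCast_atTop_of_log_div_tendsto hβ hlim).eventually_gt_atTop 0
  have hlow := hlim.eventually_const_lt (show 3 / 4 * β < β by linarith)
  have hupp := ((tendsto_add_atTop_iff_nat 1).2 hlim).eventually_lt_const
    (show β < 5 / 4 * β by linarith)
  have hpos' := (tendsto_add_atTop_iff_nat 1).2
    (tendsto_natCast_atTop_of_log_div_tendsto hβ hlim) |>.eventually_gt_atTop 0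
  filter_upwards [hpos, hpos', hlow, hupp, eventually_ge_atTop 5] with n hn hn' hl hu h5
  refine ⟨by exact_mod_cast hn, ?_⟩
  have h5' : (5 : ℝ) ≤ n := by exact_mod_cast h5
  rw [lt_div_iff₀ (by positivity)] at hl
  rw [div_lt_iff₀ (by positivity)] at hu
  push_cast at hu
  have hlog : Real.log (q (n + 1)) ≤ Real.log ((q n : ℝ) ^ 2) := by
    rw [Real.log_pow]
    push_cast
    nlinarith
  exact_mod_cast (Real.log_le_log_iff hn' (by positivity)).1 hlog

open Filter in
theorem exists_le_and_le_mul_sq {q : ℕ → ℕ} (hq : Tendsto (fun n => (q n : ℝ)) atTop atTop)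
    (hsq : ∀ᶠ n in atTop, 0 < q n ∧ q (n + 1) ≤ q n ^ 2) :
    ∃ A > (0 : ℝ), ∀ M ≥ (1 : ℝ), ∃ n, 0 < q n ∧ M ≤ q n ∧ (q n : ℝ) ≤ A * M ^ 2 := by
  classical
  obtain ⟨N, hN⟩ := eventually_atTop.1 hsq
  refine ⟨q N + 1, by positivity, fun M hM => ?_⟩
  have hex : ∃ j, M ≤ q (N + j) := by
    obtain ⟨n, hn, hNn⟩ := ((hq.eventually_ge_atTop M).and (eventually_ge_atTop N)).exists
    exact ⟨n - N, by rwa [Nat.add_sub_cancel' hNn]⟩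
  refine ⟨N + Nat.find hex, (hN _ (Nat.le_add_right _ _)).1, Nat.find_spec hex, ?_⟩
  have hM2 : 1 ≤ M ^ 2 := one_le_pow₀ hM
  have hqN : (0 : ℝ) ≤ q N := Nat.cast_nonneg _
  rcases hj : Nat.find hex with _ | j
  · rw [Nat.add_zero]
    nlinarith
  · have hlt : (q (N + j) : ℝ) < M := not_le.1 (Nat.find_min hex (by omega))
    have hle : (q (N + (j + 1)) : ℝ) ≤ (q (N + j) : ℝ) ^ 2 := by
      exact_mod_cast (hN (N + j) (Nat.le_add_right _ _)).2
    calc (q (N + (j + 1)) : ℝ) ≤ (q (N + j) : ℝ) ^ 2 := hle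
      _ ≤ M ^ 2 := by gcongr
      _ ≤ (q N + 1) * M ^ 2 := by nlinarith

/-- Khintchin-type hitting estimate: if `α ∈ (0,1)` is irrational with continued fraction
denominators `q 1 < q 2 < …` satisfying `(ln q n)/n → β > 0`, then for every `ε > 0` there is
`C > 0` such that for every `μ ∈ (0,1/2)` and every `x` in `ℝ/ℤ`, the orbit
`{x + k α : 0 ≤ k ≤ ⌈C/μ^(2+ε)⌉}` is `μ`-dense (every point is within `μ/2` of it). -/
theorem stmt_3 (α : ℝ) (hα : Irrational α) (hα01 : α ∈ Set.Ioo (0 : ℝ) 1)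
    (q : ℕ → ℕ) (hq : ∀ n, ((q n : ℝ)) = (GenContFract.of α).dens n)
    (hqmono : ∀ n ≥ 1, q n < q (n + 1))
    (β : ℝ) (hβ : 0 < β)
    (hlim : Filter.Tendsto (fun n : ℕ => Real.log (q n) / n) Filter.atTop (nhds β)) :
    ∀ ε > (0 : ℝ), ∃ C > (0 : ℝ), ∀ μ : ℝ, 0 < μ → μ < 1 / 2 →
      ∀ x y : AddCircle (1 : ℝ), ∃ k : ℕ, k ≤ ⌈C / μ ^ (2 + ε)⌉₊ ∧
        dist y (x + k • ((α : AddCircle (1 : ℝ)))) ≤ μ / 2 := by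
  intro ε hε
  obtain ⟨A, hA, hAM⟩ := exists_le_and_le_mul_sq
    (tendsto_natCast_atTop_of_log_div_tendsto hβ hlim)
    (eventually_succ_le_sq_of_log_div_tendsto hβ hlim)
  refine ⟨A * 9, by positivity, fun μ hμ hμ2 x y => ?_⟩
  obtain ⟨n, hn, hMn, hnA⟩ := hAM (3 / μ) (by rw [ge_iff_le, le_div_iff₀ hμ]; linarith)
  obtain ⟨p, hp, hαp⟩ := GenContFract.exists_isCoprime_abs_sub_div_le hα hq hn
  obtain ⟨k, hk, hdist⟩ := AddCircle.exists_dist_add_nsmul_le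
    (exists_nat_lt_abs_sub_mul_sub_le hn hp hαp) x y
  have hn' : (0 : ℝ) < q n := by exact_mod_cast hn
  refine ⟨k, ?_, hdist.trans ?_⟩
  · have hpow : μ ^ (2 + ε) ≤ μ ^ 2 := by
      rw [← Real.rpow_natCast μ 2]
      exact Real.rpow_le_rpow_of_exponent_ge hμ (by linarith) (by push_cast; linarith)
    have hμε : 0 < μ ^ (2 + ε) := Real.rpow_pos_of_pos hμ _
    have hle : (k : ℝ) ≤ A * 9 / μ ^ (2 + ε) := calc
      (k : ℝ) ≤ q n := by exact_mod_cast hk.le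
      _ ≤ A * (3 / μ) ^ 2 := hnA
      _ = A * 9 / μ ^ 2 := by field_simp; norm_num
      _ ≤ A * 9 / μ ^ (2 + ε) := by gcongr
    exact_mod_cast hle.trans (Nat.le_ceil _)
  · rw [div_le_iff₀ hμ] at hMn
    rw [div_le_div_iff₀ (by positivity) two_pos]
    linarith
end

section
/- Let α ∈ (0,1) be irrational with continued fraction (convergent) denominators (q_n), and let μ ∈ (0, 1/2) and n be such that q_{n+1} > 1/μ. Then for every x in the circle ℝ/ℤ, the set {x + kα (mod 1) : 0 ≤ k ≤ 2·q_{n+1}·q_n} is μ-dense in ℝ/ℤ, i.e., every point of ℝ/ℤ is at distance at most μ from this set. -/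
/-- The continuants of the continued fraction of `v` are integers. -/
theorem GenContFract.exists_int_contsAux_eq {K : Type*} [Field K] [LinearOrder K]
    [IsStrictOrderedRing K] [FloorRing K] (v : K) (n : ℕ) :
    ∃ a b : ℤ, (GenContFract.of v).contsAux n = ⟨(a : K), (b : K)⟩ := by
  suffices h : (∃ a b : ℤ, (GenContFract.of v).contsAux n = ⟨(a : K), (b : K)⟩) ∧
      ∃ a b : ℤ, (GenContFract.of v).contsAux (n + 1) = ⟨(a : K), (b : K)⟩ from h.1
  induction n with
  | zero =>
    refine ⟨⟨1, 0, ?_⟩, ⌊v⌋, 1, ?_⟩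
    · simp [GenContFract.contsAux]
    · simp [GenContFract.contsAux, GenContFract.of_h_eq_floor]
  | succ n ih =>
    obtain ⟨⟨a, b, hab⟩, c, d, hcd⟩ := ih
    refine ⟨⟨c, d, hcd⟩, ?_⟩
    cases hs : (GenContFract.of v).s.get? n with
    | none =>
      refine ⟨c, d, ?_⟩
      rw [GenContFract.contsAux_stable_step_of_terminated hs, hcd]
    | some gp =>
      obtain ⟨ha, z, hz⟩ := GenContFract.of_partNum_eq_one_and_exists_int_partDen_eq hs
      refine ⟨z * c + a, z * d + b, ?_⟩
      rw [GenContFract.contsAux_recurrence hs hab hcd, ha, hz]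
      push_cast
      simp

theorem GenContFract.exists_int_conts_eq {K : Type*} [Field K] [LinearOrder K]
    [IsStrictOrderedRing K] [FloorRing K] (v : K) (n : ℕ) :
    ∃ a b : ℤ, (GenContFract.of v).nums n = a ∧ (GenContFract.of v).dens n = b := by
  obtain ⟨a, b, h⟩ := GenContFract.exists_int_contsAux_eq v (n + 1)
  refine ⟨a, b, ?_, ?_⟩
  · rw [GenContFract.num_eq_conts_a, GenContFract.nth_cont_eq_succ_nth_contAux, h]
  · rw [GenContFract.den_eq_conts_b, GenContFract.nth_cont_eq_succ_nth_contAux, h]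

theorem Irrational.not_terminatedAt_of {α : ℝ} (hα : Irrational α) (n : ℕ) :
    ¬(GenContFract.of α).TerminatedAt n := fun h =>
  let ⟨r, hr⟩ := GenContFract.exists_rat_eq_of_terminates (v := α) ⟨n, h⟩
  hα ⟨r, hr.symm⟩

theorem Irrational.one_le_dens_of {α : ℝ} (hα : Irrational α) (n : ℕ) :
    1 ≤ (GenContFract.of α).dens n := by
  refine le_trans ?_ (GenContFract.succ_nth_fib_le_of_nth_den (.inr (hα.not_terminatedAt_of _)))
  exact_mod_cast Nat.fib_pos.2 n.succ_pos

/-- The convergents of an irrational number are reduced fractions `p / d` that approximate it to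
within `1 / d ^ 2`. -/
theorem Irrational.exists_isCoprime_dens_of {α : ℝ} (hα : Irrational α) {n d : ℕ}
    (hd : (d : ℝ) = (GenContFract.of α).dens n) :
    ∃ p : ℤ, IsCoprime p (d : ℤ) ∧ |d * α - p| ≤ 1 / d := by
  obtain ⟨p, -, hp, -⟩ := GenContFract.exists_int_conts_eq α n
  obtain ⟨p', d', hp', hd'⟩ := GenContFract.exists_int_conts_eq α (n + 1)
  refine ⟨p, ?_, ?_⟩
  · have h := SimpContFract.determinant (s := SimpContFract.of α) (hα.not_terminatedAt_of n)
    change (GenContFract.of α).nums n * (GenContFract.of α).dens (n + 1) -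
      (GenContFract.of α).dens n * (GenContFract.of α).nums (n + 1) = (-1) ^ (n + 1) at h
    rw [hp, hp', hd', ← hd] at h
    have h' : p * d' - d * p' = (-1) ^ (n + 1) := by exact_mod_cast h
    have hsq : ((-1 : ℤ) ^ (n + 1)) * (-1) ^ (n + 1) = 1 := by
      rw [← mul_pow]; simp
    refine ⟨(-1) ^ (n + 1) * d', -(-1) ^ (n + 1) * p', ?_⟩
    linear_combination (-1) ^ (n + 1) * h' + hsq
  · have h := GenContFract.abs_sub_convs_le (hα.not_terminatedAt_of n)
    have hmono := GenContFract.of_den_mono (v := α) (n := n)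
    have hd1 := hα.one_le_dens_of n
    rw [GenContFract.conv_eq_num_div_den, hp] at h
    rw [← hd] at h hmono hd1
    have hd0 : (0 : ℝ) < d := by linarith
    calc |d * α - p| = d * |α - p / d| := by
          rw [← abs_of_pos hd0, ← abs_mul, abs_of_pos hd0]
          congr 1
          field_simp
      _ ≤ d * (1 / (d * (GenContFract.of α).dens (n + 1))) := by gcongr
      _ = 1 / (GenContFract.of α).dens (n + 1) := by
          field_simp
      _ ≤ 1 / d := one_div_le_one_div_of_le hd0 hmono

/-- If `p / d` is a reduced fraction within `1 / d ^ 2` of `α`, then the first `d` multiples of `α`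
are `1 / d`-dense modulo `1`. -/
theorem exists_abs_sub_mul_add_int_le {α : ℝ} {p : ℤ} {d : ℕ} (hd : 0 < d)
    (hpd : IsCoprime p (d : ℤ)) (h : |d * α - p| ≤ 1 / d) (z : ℝ) :
    ∃ k < d, ∃ m : ℤ, |z - (k * α + m)| ≤ 1 / d := by
  have hd0 : (0 : ℝ) < d := by exact_mod_cast hd
  have hsolve (j : ℤ) : ∃ k < d, ∃ m : ℤ, (k : ℤ) * p + d * m = j := by
    obtain ⟨u, v, huv⟩ := hpd
    have hdz : (0 : ℤ) < d := by exact_mod_cast hd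
    have hk0 := Int.emod_nonneg (j * u) hdz.ne'
    have hk1 := Int.emod_lt_of_pos (j * u) hdz
    refine ⟨(j * u % d).toNat, by lia, j * u / d * p + j * v, ?_⟩
    rw [Int.toNat_of_nonneg hk0]
    linear_combination p * Int.emod_add_mul_ediv (j * u) d + j * huv
  have hround : ∃ j : ℤ, ∀ t ∈ Set.Icc (0 : ℝ) 1, |d * z - j - t * (d * (d * α - p))| ≤ 1 := by
    have hε : |d * (d * α - p)| ≤ 1 := by
      rw [abs_mul, abs_of_pos hd0]
      calc d * |d * α - p| ≤ d * (1 / d) := by gcongr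
        _ = 1 := by field_simp
    generalize d * (d * α - p) = ε at hε
    obtain ⟨hε₁, hε₂⟩ := abs_le.1 hε
    rcases le_total 0 ε with hε | hε
    · refine ⟨⌊d * z⌋, fun t ht => ?_⟩
      have h₁ := Int.floor_le (d * z)
      have h₂ := Int.lt_floor_add_one (d * z)
      rw [abs_le]
      constructor <;> nlinarith [ht.1, ht.2]
    · refine ⟨⌈d * z⌉, fun t ht => ?_⟩
      have h₁ := Int.le_ceil (d * z)
      have h₂ := Int.ceil_lt_add_one (d * z)
      rw [abs_le]
      constructor <;> nlinarith [ht.1, ht.2]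
  obtain ⟨j, hj⟩ := hround
  obtain ⟨k, hk, m, hkm⟩ := hsolve j
  refine ⟨k, hk, m, ?_⟩
  have hkd : (k : ℝ) ≤ d := by exact_mod_cast hk.le
  have hkm' : (k : ℝ) * p + d * m = j := by exact_mod_cast hkm
  have := hj (k / d) ⟨by positivity, div_le_one_of_le₀ hkd hd0.le⟩
  rw [le_div_iff₀ hd0]
  calc |z - (k * α + m)| * d = |(z - (k * α + m)) * d| := by rw [abs_mul, abs_of_pos hd0]
    _ = |d * z - j - k / d * (d * (d * α - p))| := by
      rw [← hkm']
      congr 1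
      field_simp
      ring
    _ ≤ 1 := this


/-- If `α ∈ (0,1)` is irrational with continued fraction denominators `q`, and `μ ∈ (0,1/2)`,
`n` are such that `q (n+1) > 1/μ`, then for every `x` in `ℝ/ℤ` the set
`{x + k α : 0 ≤ k ≤ 2 q_{n+1} q_n}` is `μ`-dense: every point of `ℝ/ℤ` is within distance `μ`
of this set. -/
theorem stmt_4 (α : ℝ) (hα : Irrational α) (hα01 : α ∈ Set.Ioo (0 : ℝ) 1)
    (q : ℕ → ℕ) (hq : ∀ m, ((q m : ℝ)) = (GenContFract.of α).dens m)
    (μ : ℝ) (hμ0 : 0 < μ) (hμ : μ < 1 / 2) (n : ℕ) (hqn : (1 : ℝ) / μ < q (n + 1)) :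
    ∀ x y : AddCircle (1 : ℝ), ∃ k : ℕ, k ≤ 2 * q (n + 1) * q n ∧
      dist y (x + k • ((α : AddCircle (1 : ℝ)))) ≤ μ := by
  intro x y
  have hq1 (m : ℕ) : 1 ≤ q m := by
    have := hα.one_le_dens_of m
    rw [← hq m] at this
    exact_mod_cast this
  obtain ⟨p, hp, hpα⟩ := hα.exists_isCoprime_dens_of (hq (n + 1))
  obtain ⟨z, hz⟩ := QuotientAddGroup.mk_surjective (y - x)
  obtain ⟨k, hk, m, hkm⟩ := exists_abs_sub_mul_add_int_le (hq1 (n + 1)) hp hpα z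
  refine ⟨k, ?_, ?_⟩
  · nlinarith [hq1 n, Nat.mul_le_mul_left (q (n + 1)) (hq1 n)]
  have hrep : y - (x + k • (α : AddCircle (1 : ℝ))) =
      ((z - (k * α + m) : ℝ) : AddCircle (1 : ℝ)) := by
    have hm : ((m : ℝ) : AddCircle (1 : ℝ)) = 0 :=
      (AddCircle.coe_eq_zero_iff 1).2 ⟨m, by simp⟩
    rw [← sub_sub, ← hz, AddCircle.coe_sub, AddCircle.coe_add, hm, add_zero, ← nsmul_eq_mul,
      AddCircle.coe_nsmul]
  rw [dist_eq_norm, hrep]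
  calc ‖((z - (k * α + m) : ℝ) : AddCircle (1 : ℝ))‖ ≤ |z - (k * α + m)| := by
        rw [UnitAddCircle.norm_eq]
        simpa using round_le (z - (k * α + m)) 0
    _ ≤ 1 / q (n + 1) := hkm
    _ ≤ μ := ((one_div_lt hμ0 (by exact_mod_cast hq1 (n + 1))).1 hqn).le
end

section
/- Let α be a real number, let q be a positive integer, and set δ = dist(q·α, ℤ) (the distance from q·α to the nearest integer); assume δ > 0. Then for every x and y in the circle ℝ/ℤ there exists a natural number j with 0 ≤ j ≤ ⌈1/δ⌉ such that dist(y, x + j·q·α) ≤ δ. In particular, the set {x + kα (mod 1) : 0 ≤ k ≤ q·⌈1/δ⌉} is within distance δ of every point of ℝ/ℤ. -/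
theorem UnitAddCircle.norm_coe_le_abs (t : ℝ) : ‖(t : UnitAddCircle)‖ ≤ |t| := by
  rw [UnitAddCircle.norm_eq]
  simpa using round_le t 0

/-- The multiples `0, δ, …, ⌈1/δ⌉ δ` of a positive real `δ` are `δ`-dense in the circle. -/
theorem UnitAddCircle.exists_norm_sub_nsmul_le {δ : ℝ} (hδ : 0 < δ) (z : UnitAddCircle) :
    ∃ j : ℕ, j ≤ ⌈1 / δ⌉₊ ∧ ‖z - j • (δ : UnitAddCircle)‖ ≤ δ := by
  obtain ⟨r, rfl⟩ := QuotientAddGroup.mk_surjective z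
  have hr : ((Int.fract r : ℝ) : UnitAddCircle) = r := by
    rw [Int.fract, AddCircle.coe_sub, sub_eq_self, AddCircle.coe_eq_zero_iff]
    exact ⟨⌊r⌋, by simp⟩
  have hquot : 0 ≤ Int.fract r / δ := div_nonneg (Int.fract_nonneg r) hδ.le
  refine ⟨⌊Int.fract r / δ⌋₊, ?_, ?_⟩
  · refine (Nat.floor_le_floor ?_).trans (Nat.floor_le_ceil _)
    gcongr
    exact (Int.fract_lt_one r).le
  · change ‖(r : UnitAddCircle) - _‖ ≤ δ
    rw [← hr, ← AddCircle.coe_nsmul, ← AddCircle.coe_sub]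
    refine (UnitAddCircle.norm_coe_le_abs _).trans ?_
    have hlow := (le_div_iff₀ hδ).1 (Nat.floor_le hquot)
    have hupp := (div_lt_iff₀ hδ).1 (Nat.lt_floor_add_one (Int.fract r / δ))
    rw [nsmul_eq_mul, abs_le]
    constructor <;> linarith

/-- The multiples `0, w, …, ⌈1/‖w‖⌉ w` of a nonzero point `w` are `‖w‖`-dense in the circle. -/
theorem UnitAddCircle.exists_norm_sub_nsmul_le_norm {w : UnitAddCircle} (hw : 0 < ‖w‖)
    (z : UnitAddCircle) : ∃ j : ℕ, j ≤ ⌈1 / ‖w‖⌉₊ ∧ ‖z - j • w‖ ≤ ‖w‖ := by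
  obtain ⟨b, rfl⟩ := QuotientAddGroup.mk_surjective w
  change 0 < ‖(b : UnitAddCircle)‖ at hw
  change ∃ j : ℕ, j ≤ ⌈1 / ‖(b : UnitAddCircle)‖⌉₊ ∧
    ‖z - j • (b : UnitAddCircle)‖ ≤ ‖(b : UnitAddCircle)‖
  have hb : ((b - round b : ℝ) : UnitAddCircle) = b := by
    rw [AddCircle.coe_sub, sub_eq_self, AddCircle.coe_eq_zero_iff]
    exact ⟨round b, by simp⟩
  have hnorm : ‖(b : UnitAddCircle)‖ = |b - round b| := UnitAddCircle.norm_eq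
  rcases abs_choice (b - round b) with h | h
  · have hcoe : ((‖(b : UnitAddCircle)‖ : ℝ) : UnitAddCircle) = b := by rw [hnorm, h, hb]
    simpa only [hcoe] using UnitAddCircle.exists_norm_sub_nsmul_le hw z
  · have hcoe : ((‖(b : UnitAddCircle)‖ : ℝ) : UnitAddCircle) = -b := by
      rw [hnorm, h, AddCircle.coe_neg, hb]
    obtain ⟨j, hj, hle⟩ := UnitAddCircle.exists_norm_sub_nsmul_le hw (-z)
    refine ⟨j, hj, ?_⟩
    rwa [hcoe, smul_neg, ← neg_sub', norm_neg] at hle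

/-- Let `δ = dist(qα, ℤ) > 0` (the norm of `qα` in `ℝ/ℤ`).  Then any point `y` of the circle is
within distance `δ` of `x + j q α` for some `0 ≤ j ≤ ⌈1/δ⌉`; in particular the orbit
`{x + k α : 0 ≤ k ≤ q ⌈1/δ⌉}` comes within `δ` of every point. -/
theorem stmt_5 (α : ℝ) (q : ℕ) (hq : 0 < q) (δ : ℝ)
    (hδdef : δ = ‖(((q : ℝ) * α : ℝ) : AddCircle (1 : ℝ))‖) (hδ : 0 < δ) :
    ∀ x y : AddCircle (1 : ℝ),
      (∃ j : ℕ, j ≤ ⌈1 / δ⌉₊ ∧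
        dist y (x + (j * q) • ((α : AddCircle (1 : ℝ)))) ≤ δ) ∧
      (∃ k : ℕ, k ≤ q * ⌈1 / δ⌉₊ ∧
        dist y (x + k • ((α : AddCircle (1 : ℝ)))) ≤ δ) := by
  intro x y
  have hcoe : (((q : ℝ) * α : ℝ) : AddCircle (1 : ℝ)) = q • (α : AddCircle (1 : ℝ)) := by
    rw [← nsmul_eq_mul, AddCircle.coe_nsmul]
  rw [hcoe] at hδdef
  subst hδdef
  obtain ⟨j, hj, hle⟩ := UnitAddCircle.exists_norm_sub_nsmul_le_norm hδ (y - x)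
  have hdist : dist y (x + (j * q) • (α : AddCircle (1 : ℝ))) ≤
      ‖q • (α : AddCircle (1 : ℝ))‖ := by
    rwa [dist_eq_norm, ← sub_sub, mul_nsmul']
  exact ⟨⟨j, hj, hdist⟩, j * q, by rw [mul_comm]; gcongr, hdist⟩
end
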